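/- arXiv:1404.4171 — 5 statements merged into one kernel-verified Lean document; each statement's English description precedes it below -/
import Mathlib

section
/- For every c > 0 and every real number ζ, the integral over λ ∈ (0, ∞) of (2πλ)^{-1/2} · exp(−(λ + cζ)²/(2λ)) dλ equals exp(−2c · max(0, ζ)). (Scale-mixture representation of the exponentiated hinge loss.) -/
open MeasureTheory Real

/-- The positive root `x` of `x - b / x = u`. -/
noncomputable def posRoot (b u : ℝ) : ℝ := (u + √(u ^ 2 + 4 * b)) / 2

lemma posRoot_pos {b : ℝ} (hb : 0 < b) (u : ℝ) : 0 < posRoot b u := by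
  have h : |u| < √(u ^ 2 + 4 * b) := by
    rw [← sqrt_sq_eq_abs]
    exact sqrt_lt_sqrt (sq_nonneg u) (by linarith)
  have := neg_abs_le u
  unfold posRoot
  linarith

lemma posRoot_sq {b : ℝ} (hb : 0 < b) (u : ℝ) : posRoot b u ^ 2 = u * posRoot b u + b := by
  have h : √(u ^ 2 + 4 * b) ^ 2 = u ^ 2 + 4 * b := sq_sqrt (by positivity)
  unfold posRoot
  linear_combination h / 4

lemma hasDerivAt_posRoot {b : ℝ} (hb : 0 < b) (u : ℝ) :
    HasDerivAt (posRoot b) (posRoot b u / √(u ^ 2 + 4 * b)) u := by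
  have hs : 0 < u ^ 2 + 4 * b := by positivity
  have hs' : √(u ^ 2 + 4 * b) ≠ 0 := (sqrt_pos.2 hs).ne'
  have h := ((hasDerivAt_id u).add
    ((((hasDerivAt_id u).pow 2).add_const (4 * b)).sqrt hs.ne')).div_const 2
  refine h.congr_deriv ?_
  simp only [posRoot, id, Pi.pow_apply]
  field_simp
  ring

lemma strictMono_posRoot {b : ℝ} (hb : 0 < b) : StrictMono (posRoot b) :=
  strictMono_of_hasDerivAt_pos (hasDerivAt_posRoot hb) fun u =>
    div_pos (posRoot_pos hb u) (sqrt_pos.2 (by positivity))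

lemma posRoot_sub_div {b x : ℝ} (hb : 0 < b) (hx : 0 < x) : posRoot b (x - b / x) = x := by
  have h : (x - b / x) ^ 2 + 4 * b = (x + b / x) ^ 2 := by field_simp; ring
  rw [posRoot, h, sqrt_sq (by positivity)]
  ring

lemma image_posRoot_sq {b : ℝ} (hb : 0 < b) :
    (fun u => posRoot b u ^ 2) '' Set.univ = Set.Ioi 0 := by
  ext l
  constructor
  · rintro ⟨u, -, rfl⟩
    exact pow_pos (posRoot_pos hb u) 2
  · intro hl
    exact ⟨√l - b / √l, trivial, by
      simp only [posRoot_sub_div hb (sqrt_pos.2 hl), sq_sqrt (Set.mem_Ioi.1 hl).le]⟩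

lemma integral_odd_mul_exp_eq_zero (b : ℝ) :
    ∫ u : ℝ, u / √(u ^ 2 + 4 * b) * exp (-(1 / 2) * u ^ 2) = 0 := by
  have h := integral_neg_eq_self (fun u : ℝ => u / √(u ^ 2 + 4 * b) * exp (-(1 / 2) * u ^ 2)) volume
  simp only [neg_sq, neg_div, neg_mul, integral_neg] at h ⊢
  linarith

lemma integrable_odd_mul_exp {b : ℝ} (hb : 0 < b) :
    Integrable fun u : ℝ => u / √(u ^ 2 + 4 * b) * exp (-(1 / 2) * u ^ 2) := by
  refine (integrable_exp_neg_mul_sq (b := 1 / 2) (by norm_num)).bdd_mul (c := 1) ?_ ?_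
  · exact (by fun_prop : Measurable fun u : ℝ => u / √(u ^ 2 + 4 * b)).aestronglyMeasurable
  · refine Filter.Eventually.of_forall fun u => ?_
    rw [norm_div, norm_of_nonneg (sqrt_nonneg _), norm_eq_abs]
    refine div_le_one_of_le₀ ?_ (sqrt_nonneg _)
    rw [← sqrt_sq_eq_abs]
    exact sqrt_le_sqrt (by linarith)

lemma rpow_neg_half_eq {l : ℝ} (hl : 0 ≤ l) :
    (2 * π * l) ^ (-(1 : ℝ) / 2) = (√(2 * π))⁻¹ * (√l)⁻¹ := by
  rw [neg_div, rpow_neg (by positivity), ← sqrt_eq_rpow, sqrt_mul (by positivity), mul_inv]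

lemma integral_scale_mixture_of_pos {b : ℝ} (hb : 0 < b) :
    ∫ l in Set.Ioi (0 : ℝ), (2 * π * l) ^ (-(1 : ℝ) / 2) * exp (-(l - b) ^ 2 / (2 * l)) = 1 := by
  have hderiv (u : ℝ) : HasDerivAt (fun u => posRoot b u ^ 2)
      (2 * posRoot b u * (posRoot b u / √(u ^ 2 + 4 * b))) u := by
    exact ((hasDerivAt_posRoot hb u).pow 2).congr_deriv (by simp)
  have hinj : Set.InjOn (fun u => posRoot b u ^ 2) Set.univ := fun u _ v _ h =>
    (strictMono_posRoot hb).injective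
      ((pow_left_inj₀ (posRoot_pos hb u).le (posRoot_pos hb v).le two_ne_zero).1 h)
  have hpt (u : ℝ) : |2 * posRoot b u * (posRoot b u / √(u ^ 2 + 4 * b))| •
      ((2 * π * posRoot b u ^ 2) ^ (-(1 : ℝ) / 2) *
        exp (-(posRoot b u ^ 2 - b) ^ 2 / (2 * posRoot b u ^ 2))) =
      (√(2 * π))⁻¹ * (exp (-(1 / 2) * u ^ 2) +
        u / √(u ^ 2 + 4 * b) * exp (-(1 / 2) * u ^ 2)) := by
    have hx := posRoot_pos hb u
    have hs : 0 < √(u ^ 2 + 4 * b) := sqrt_pos.2 (by positivity)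
    have hexp : -(posRoot b u ^ 2 - b) ^ 2 / (2 * posRoot b u ^ 2) = -(1 / 2) * u ^ 2 := by
      rw [show posRoot b u ^ 2 - b = u * posRoot b u by linarith [posRoot_sq hb u]]
      field_simp
    have hdouble : 2 * posRoot b u = u + √(u ^ 2 + 4 * b) := by unfold posRoot; ring
    rw [abs_of_pos (by positivity), rpow_neg_half_eq (by positivity), sqrt_sq hx.le, hexp,
      smul_eq_mul]
    field_simp
    rw [hdouble]
    ring
  rw [← image_posRoot_sq hb, integral_image_eq_integral_abs_deriv_smul MeasurableSet.univ
    (fun u _ => (hderiv u).hasDerivWithinAt) hinj]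
  simp only [hpt, Measure.restrict_univ]
  rw [integral_const_mul, integral_add (integrable_exp_neg_mul_sq (by norm_num))
    (integrable_odd_mul_exp hb), integral_odd_mul_exp_eq_zero, integral_gaussian, add_zero,
    show π / (1 / 2) = 2 * π by ring]
  exact inv_mul_cancel₀ (by positivity)

lemma integral_scale_mixture_zero :
    ∫ l in Set.Ioi (0 : ℝ), (2 * π * l) ^ (-(1 : ℝ) / 2) * exp (-l ^ 2 / (2 * l)) = 1 := by
  have h := integral_rpow_mul_exp_neg_mul_Ioi (a := 1 / 2) (r := 1 / 2) (by norm_num) (by norm_num)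
  rw [Gamma_one_half_eq, ← sqrt_eq_rpow, ← sqrt_mul (by norm_num)] at h
  have hpt : ∀ l ∈ Set.Ioi (0 : ℝ), (2 * π * l) ^ (-(1 : ℝ) / 2) * exp (-l ^ 2 / (2 * l)) =
      (√(2 * π))⁻¹ * (l ^ ((1 : ℝ) / 2 - 1) * exp (-(1 / 2 * l))) := by
    intro l hl
    have hl' : 0 < l := hl
    rw [rpow_neg_half_eq hl'.le, show (1 : ℝ) / 2 - 1 = -(1 / 2) by norm_num, rpow_neg hl'.le,
      ← sqrt_eq_rpow, mul_assoc, show -l ^ 2 / (2 * l) = -(1 / 2 * l) by field_simp]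
  rw [setIntegral_congr_fun measurableSet_Ioi hpt, integral_const_mul, h,
    show (1 : ℝ) / (1 / 2) * π = 2 * π by ring]
  exact inv_mul_cancel₀ (by positivity)

lemma integral_scale_mixture_of_nonneg {b : ℝ} (hb : 0 ≤ b) :
    ∫ l in Set.Ioi (0 : ℝ), (2 * π * l) ^ (-(1 : ℝ) / 2) * exp (-(l - b) ^ 2 / (2 * l)) = 1 := by
  rcases hb.eq_or_lt with rfl | hb
  · simpa using integral_scale_mixture_zero
  · exact integral_scale_mixture_of_pos hb

/-- Scale-mixture representation of the exponentiated hinge loss: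
for every `c > 0` and `ζ : ℝ`,
`∫_{(0,∞)} (2πλ)^{-1/2} exp(-(λ + cζ)²/(2λ)) dλ = exp(-2c·max(0,ζ))`. -/
theorem scale_mixture_hinge (c : ℝ) (hc : 0 < c) (ζ : ℝ) :
    ∫ l in Set.Ioi (0 : ℝ),
        (2 * π * l) ^ (-(1 : ℝ) / 2) * Real.exp (-(l + c * ζ) ^ 2 / (2 * l))
      = Real.exp (-(2 * c * max 0 ζ)) := by
  have hmax : 2 * c * max 0 ζ = c * ζ + c * |ζ| := by
    rcases le_total 0 ζ with h | h
    · rw [max_eq_right h, abs_of_nonneg h]; ring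
    · rw [max_eq_left h, abs_of_nonpos h]; ring
  have hpt : ∀ l ∈ Set.Ioi (0 : ℝ),
      (2 * π * l) ^ (-(1 : ℝ) / 2) * exp (-(l + c * ζ) ^ 2 / (2 * l)) =
      exp (-(2 * c * max 0 ζ)) *
        ((2 * π * l) ^ (-(1 : ℝ) / 2) * exp (-(l - c * |ζ|) ^ 2 / (2 * l))) := by
    intro l hl
    have hl' : l ≠ 0 := (Set.mem_Ioi.1 hl).ne'
    rw [mul_left_comm, ← exp_add, hmax]
    congr 2
    field_simp
    linear_combination c ^ 2 * sq_abs ζ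
  rw [setIntegral_congr_fun measurableSet_Ioi hpt, integral_const_mul,
    integral_scale_mixture_of_nonneg (by positivity), mul_one]
end

section
/- For every b > 0, the integral over λ ∈ (0, ∞) of λ^{-1/2} · exp(−(λ + b/λ)/2) dλ equals √(2π) · exp(−√b). -/
open MeasureTheory Real

lemma hasDerivAt_sub_const_div (c : ℝ) {x : ℝ} (hx : x ≠ 0) :
    HasDerivAt (fun y : ℝ => y - c / y) (1 + c / x ^ 2) x := by
  have h := (hasDerivAt_id x).sub ((hasDerivAt_inv hx).const_mul c)
  refine (h.congr_deriv ?_).congr_of_eventuallyEq (.of_forall fun y => ?_)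
  · field_simp
    ring
  · simp [div_eq_mul_inv]

lemma injOn_sub_const_div {c : ℝ} (hc : 0 < c) :
    Set.InjOn (fun x : ℝ => x - c / x) (Set.Ioi 0) := by
  intro x hx y hy h
  have hx : 0 < x := hx
  have hy : 0 < y := hy
  have h : x - c / x = y - c / y := h
  have hxy : (x - y) * (x * y + c) = 0 := by
    field_simp at h
    linear_combination h
  rcases mul_eq_zero.mp hxy with h | h
  · linarith
  · nlinarith [mul_pos hx hy]

lemma image_sub_const_div_Ioi {c : ℝ} (hc : 0 < c) :
    (fun x : ℝ => x - c / x) '' Set.Ioi 0 = Set.univ := by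
  refine Set.eq_univ_of_forall fun u => ?_
  have hs : √(u ^ 2 + 4 * c) ^ 2 = u ^ 2 + 4 * c := sq_sqrt (by positivity)
  have hpos : 0 < u + √(u ^ 2 + 4 * c) := by
    have : |u| < √(u ^ 2 + 4 * c) := by
      rw [← sqrt_sq_eq_abs]
      exact sqrt_lt_sqrt (sq_nonneg u) (by linarith)
    linarith [neg_abs_le u]
  refine ⟨(u + √(u ^ 2 + 4 * c)) / 2, half_pos hpos, ?_⟩
  have := hpos.ne'
  field_simp
  linear_combination hs

lemma image_const_div_Ioi {c : ℝ} (hc : 0 < c) :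
    (fun x : ℝ => c / x) '' Set.Ioi 0 = Set.Ioi 0 := by
  ext y
  constructor
  · rintro ⟨x, hx, rfl⟩
    exact div_pos hc hx
  · intro hy
    exact ⟨c / y, div_pos hc hy, div_div_cancel₀ hc.ne'⟩

/-- Inversion `x ↦ c / x` as a change of variables on `(0, ∞)`. -/
lemma integral_Ioi_comp_const_div {c : ℝ} (hc : 0 < c) (g : ℝ → ℝ) :
    ∫ x in Set.Ioi (0 : ℝ), c / x ^ 2 * g (c / x) = ∫ x in Set.Ioi (0 : ℝ), g x := by
  have hinj : Set.InjOn (fun x : ℝ => c / x) (Set.Ioi 0) := fun x _ y _ h => by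
    have h : c / x = c / y := h
    rw [← div_div_cancel₀ (b := x) hc.ne', h, div_div_cancel₀ hc.ne']
  have hderiv : ∀ x ∈ Set.Ioi (0 : ℝ),
      HasDerivWithinAt (fun y : ℝ => c / y) (-(c / x ^ 2)) (Set.Ioi 0) x := fun x hx => by
    simpa [div_eq_mul_inv] using
      ((hasDerivAt_inv (ne_of_gt hx)).const_mul c).hasDerivWithinAt (s := Set.Ioi 0)
  have h := integral_image_eq_integral_abs_deriv_smul measurableSet_Ioi hderiv hinj g
  rw [image_const_div_Ioi hc] at h
  rw [h]
  refine setIntegral_congr_fun measurableSet_Ioi fun x _ => ?_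
  rw [abs_neg, abs_of_nonneg (by positivity), smul_eq_mul]

/-- The Cauchy–Schlömilch substitution for an even integrable function. -/
theorem two_mul_integral_Ioi_comp_sub_const_div {c : ℝ} (hc : 0 < c) {f : ℝ → ℝ}
    (hf : Integrable f) (heven : Function.Even f) :
    2 * ∫ x in Set.Ioi (0 : ℝ), f (x - c / x) = ∫ x, f x := by
  have hderiv : ∀ x ∈ Set.Ioi (0 : ℝ),
      HasDerivWithinAt (fun y : ℝ => y - c / y) (1 + c / x ^ 2) (Set.Ioi 0) x :=
    fun x hx => (hasDerivAt_sub_const_div c (ne_of_gt hx)).hasDerivWithinAt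
  have habs (x : ℝ) : |1 + c / x ^ 2| = 1 + c / x ^ 2 := abs_of_pos (by positivity)
  have hval := integral_image_eq_integral_abs_deriv_smul measurableSet_Ioi hderiv
    (injOn_sub_const_div hc) f
  have hint := (integrableOn_image_iff_integrableOn_abs_deriv_smul measurableSet_Ioi hderiv
    (injOn_sub_const_div hc) f).mp (by rwa [image_sub_const_div_Ioi hc, integrableOn_univ])
  simp only [image_sub_const_div_Ioi hc, Measure.restrict_univ, habs, smul_eq_mul] at hval hint
  have hcomp : IntegrableOn (fun x => f (x - c / x)) (Set.Ioi 0) := by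
    have hb : IntegrableOn
        (fun x => (1 + c / x ^ 2)⁻¹ * ((1 + c / x ^ 2) * f (x - c / x))) (Set.Ioi 0) := by
      refine Integrable.bdd_mul (c := 1) hint
        (Measurable.aestronglyMeasurable (by fun_prop)) (.of_forall fun x => ?_)
      rw [norm_inv, Real.norm_eq_abs, habs]
      exact inv_le_one_of_one_le₀ (le_add_of_nonneg_right (by positivity))
    refine hb.congr_fun (fun x _ => inv_mul_cancel_left₀ ?_ _) measurableSet_Ioi
    positivity
  have hweighted : IntegrableOn (fun x => c / x ^ 2 * f (x - c / x)) (Set.Ioi 0) :=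
    (hint.sub hcomp).congr_fun (fun x _ => by simp only [Pi.sub_apply]; ring) measurableSet_Ioi
  have hinv : ∫ x in Set.Ioi (0 : ℝ), c / x ^ 2 * f (x - c / x)
      = ∫ x in Set.Ioi (0 : ℝ), f (x - c / x) := by
    rw [← integral_Ioi_comp_const_div hc fun x => f (x - c / x)]
    refine setIntegral_congr_fun measurableSet_Ioi fun x _ => ?_
    simp only [div_div_cancel₀ hc.ne']
    rw [← heven, neg_sub]
  rw [hval]
  simp only [add_mul, one_mul]
  rw [integral_add hcomp hweighted, hinv, two_mul]

/-- For every `b > 0`, `∫_{(0,∞)} λ^{-1/2} exp(-(λ + b/λ)/2) dλ = √(2π) · exp(-√b)`. -/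
theorem gig_half_normalization (b : ℝ) (hb : 0 < b) :
    ∫ l in Set.Ioi (0 : ℝ), l ^ (-(1 : ℝ) / 2) * Real.exp (-(l + b / l) / 2)
      = Real.sqrt (2 * π) * Real.exp (-Real.sqrt b) := by
  have hgauss : ∫ x : ℝ, exp (-(1 / 2) * x ^ 2) = √(2 * π) := by
    rw [integral_gaussian]
    congr 1
    ring
  have hsub := two_mul_integral_Ioi_comp_sub_const_div (sqrt_pos.mpr hb)
    (integrable_exp_neg_mul_sq (b := 1 / 2) (by norm_num)) (fun x => by simp)
  rw [← integral_comp_rpow_Ioi_of_pos (p := 2) two_pos, ← hgauss, ← hsub, mul_comm,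
    ← mul_assoc, ← integral_const_mul]
  refine setIntegral_congr_fun measurableSet_Ioi fun x hx => ?_
  have hx : 0 < x := hx
  have hpow : (x ^ (2 : ℝ)) ^ (-(1 : ℝ) / 2) = x⁻¹ := by
    rw [← rpow_mul hx.le, ← rpow_neg_one]
    norm_num
  have hexp : -(x ^ 2 + b / x ^ 2) / 2 = -√b + -(1 / 2) * (x - √b / x) ^ 2 := by
    have hs := sq_sqrt hb.le
    field_simp
    linear_combination hs
  simp only [hpow, smul_eq_mul]
  rw [rpow_two, hexp, exp_add, show (2 : ℝ) - 1 = 1 by norm_num, rpow_one]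
  field_simp
end

section
/- For every b > 0, the integral over λ ∈ (0, ∞) of λ^{-3/2} · exp(−(λ + b/λ)/2) dλ equals √(2π/b) · exp(−√b). -/
open MeasureTheory Real

/-- Change of variables `u = sinh t` in the Gaussian integral: integrability. -/
theorem integrable_cosh_mul_exp_neg_mul_sinh_sq {a : ℝ} (ha : 0 < a) :
    Integrable fun t : ℝ => cosh t * exp (-a * sinh t ^ 2) := by
  have h := integrableOn_image_iff_integrableOn_abs_deriv_smul MeasurableSet.univ
    (fun x _ => (hasDerivAt_sinh x).hasDerivWithinAt) sinh_injective.injOn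
    (fun u : ℝ => exp (-a * u ^ 2))
  rw [Set.image_univ, sinh_surjective.range_eq, integrableOn_univ, integrableOn_univ] at h
  simpa [abs_of_pos (cosh_pos _)] using h.1 (integrable_exp_neg_mul_sq ha)

/-- Change of variables `u = sinh t` in the Gaussian integral: value. -/
theorem integral_cosh_mul_exp_neg_mul_sinh_sq (a : ℝ) :
    ∫ t : ℝ, cosh t * exp (-a * sinh t ^ 2) = √(π / a) := by
  have h := integral_image_eq_integral_abs_deriv_smul MeasurableSet.univ
    (fun x _ => (hasDerivAt_sinh x).hasDerivWithinAt) sinh_injective.injOn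
    (fun u : ℝ => exp (-a * u ^ 2))
  rw [Set.image_univ, sinh_surjective.range_eq, setIntegral_univ, setIntegral_univ,
    integral_gaussian] at h
  simpa [abs_of_pos (cosh_pos _)] using h.symm

theorem integral_exp_neg_mul_exp_neg_mul_sinh_sq {a : ℝ} (ha : 0 < a) :
    ∫ t : ℝ, exp (-t) * exp (-a * sinh t ^ 2) = √(π / a) := by
  have hcosh := integrable_cosh_mul_exp_neg_mul_sinh_sq ha
  have hsinh : Integrable fun t : ℝ => sinh t * exp (-a * sinh t ^ 2) := by
    refine hcosh.mono (by fun_prop) (.of_forall fun t => ?_)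
    rw [norm_mul, norm_mul]
    gcongr
    rw [norm_eq_abs, norm_eq_abs, ← sq_le_sq, cosh_sq]
    linarith
  have hodd : ∫ t : ℝ, sinh t * exp (-a * sinh t ^ 2) = 0 := by
    have h := integral_neg_eq_self (fun t : ℝ => sinh t * exp (-a * sinh t ^ 2)) volume
    simp only [sinh_neg, neg_sq, neg_mul, integral_neg] at h ⊢
    linarith
  simp_rw [← cosh_sub_sinh, sub_mul]
  rw [integral_sub hcosh hsinh, hodd, sub_zero, integral_cosh_mul_exp_neg_mul_sinh_sq]

/-- The substitution `l = c * exp (2 * t)` on the half-line. -/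
theorem setIntegral_Ioi_eq_integral_comp_mul_exp_two_mul {c : ℝ} (hc : 0 < c) (f : ℝ → ℝ) :
    ∫ l in Set.Ioi (0 : ℝ), f l = ∫ t : ℝ, 2 * c * exp (2 * t) * f (c * exp (2 * t)) := by
  have hderiv (t : ℝ) : HasDerivAt (fun t : ℝ => c * exp (2 * t)) (2 * c * exp (2 * t)) t := by
    have h := ((hasDerivAt_id' t).const_mul 2).exp.const_mul c
    rwa [show c * (exp (2 * t) * (2 * 1)) = 2 * c * exp (2 * t) by ring] at h
  have hinj : Function.Injective fun t : ℝ => c * exp (2 * t) := fun s t h => by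
    simpa [hc.ne'] using h
  have hrange : Set.range (fun t : ℝ => c * exp (2 * t)) = Set.Ioi 0 := by
    ext l
    refine ⟨?_, fun hl => ⟨log (l / c) / 2, ?_⟩⟩
    · rintro ⟨t, rfl⟩
      exact mul_pos hc (exp_pos _)
    · have : 0 < l / c := div_pos hl hc
      simp only [mul_div_cancel₀ _ (two_ne_zero' ℝ), exp_log this]
      field_simp
  have h := integral_image_eq_integral_abs_deriv_smul MeasurableSet.univ
    (fun t _ => (hderiv t).hasDerivWithinAt) hinj.injOn f
  rw [Set.image_univ, hrange, setIntegral_univ] at h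
  rw [h]
  refine integral_congr_ae (.of_forall fun t => ?_)
  simp only [smul_eq_mul]
  rw [abs_of_pos (by positivity)]

/-- For every `b > 0`, `∫_{(0,∞)} λ^{-3/2} exp(-(λ + b/λ)/2) dλ = √(2π/b) · exp(-√b)`. -/
theorem gig_neg_half_normalization (b : ℝ) (hb : 0 < b) :
    ∫ l in Set.Ioi (0 : ℝ), l ^ (-(3 : ℝ) / 2) * Real.exp (-(l + b / l) / 2)
      = Real.sqrt (2 * π / b) * Real.exp (-Real.sqrt b) := by
  obtain ⟨c, hc, rfl⟩ : ∃ c : ℝ, 0 < c ∧ b = c ^ 2 := ⟨√b, sqrt_pos.2 hb, (sq_sqrt hb.le).symm⟩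
  have hpt (t : ℝ) : 2 * c * exp (2 * t) * ((c * exp (2 * t)) ^ (-(3 : ℝ) / 2) *
      exp (-(c * exp (2 * t) + c ^ 2 / (c * exp (2 * t))) / 2)) =
      2 * c ^ (-(1 : ℝ) / 2) * exp (-c) * (exp (-t) * exp (-(2 * c) * sinh t ^ 2)) := by
    have hexponent : -(c * exp (2 * t) + c ^ 2 / (c * exp (2 * t))) / 2 =
        -c + -(2 * c) * sinh t ^ 2 := by
      rw [sinh_eq, exp_neg, two_mul t, exp_add]
      field_simp
      ring
    have hc_rpow : c * c ^ (-(3 : ℝ) / 2) = c ^ (-(1 : ℝ) / 2) := by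
      rw [← rpow_one_add' hc.le (by norm_num)]
      norm_num
    have hexp : exp (2 * t) * exp (2 * t * (-(3 : ℝ) / 2)) = exp (-t) := by
      rw [← exp_add]
      ring_nf
    rw [hexponent, exp_add, mul_rpow hc.le (exp_pos _).le, ← exp_mul, ← hc_rpow, ← hexp]
    ring
  rw [setIntegral_Ioi_eq_integral_comp_mul_exp_two_mul hc]
  simp_rw [hpt]
  rw [integral_const_mul, integral_exp_neg_mul_exp_neg_mul_sinh_sq (by positivity), sqrt_sq hc.le,
    neg_div, rpow_neg hc.le, ← sqrt_eq_rpow, sqrt_div (by positivity), sqrt_div (by positivity),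
    sqrt_sq hc.le, sqrt_mul zero_le_two, sqrt_mul zero_le_two]
  field_simp
  rw [sq_sqrt hc.le, sq_sqrt zero_le_two, mul_comm]
end

section
/- Let c > 0 and ζ ∈ ℝ, and let q be a probability density on (0, ∞) such that λ ↦ q(λ) log q(λ), λ ↦ q(λ) log λ, λ ↦ λ q(λ), and λ ↦ q(λ)/λ are all integrable. Then 2c · max(0, ζ) ≤ ∫₀^∞ q(λ) [ log q(λ) + (1/2) log(2πλ) + (λ + cζ)²/(2λ) ] dλ. (Variational upper bound on the hinge loss obtained from the scale-mixture representation and Jensen's inequality.) -/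
open MeasureTheory Real

open ProbabilityTheory Filter Topology

/-- The cumulative distribution function of the standard Gaussian is differentiable, with
derivative the Gaussian density. -/
lemma hasDerivAt_cdf_gaussianReal (x : ℝ) :
    HasDerivAt (cdf (gaussianReal 0 1)) (gaussianPDFReal 0 1 x) x := by
  have hint : Integrable (gaussianPDFReal 0 1) := integrable_gaussianPDFReal 0 1
  have hcont : Continuous (gaussianPDFReal 0 1) := by
    rw [gaussianPDFReal_def]; fun_prop
  have hcdf : ∀ y, cdf (gaussianReal 0 1) y = ∫ t in Set.Iic y, gaussianPDFReal 0 1 t := by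
    intro y
    rw [cdf_eq_real, measureReal_def, gaussianReal_apply_eq_integral 0 one_ne_zero,
      ENNReal.toReal_ofReal (integral_nonneg (gaussianPDFReal_nonneg 0 1))]
  have hsplit : ∀ y, cdf (gaussianReal 0 1) y =
      cdf (gaussianReal 0 1) 0 + ∫ t in (0 : ℝ)..y, gaussianPDFReal 0 1 t := by
    intro y
    rw [← intervalIntegral.integral_Iic_sub_Iic hint.integrableOn hint.integrableOn, hcdf, hcdf]
    ring
  have hderiv := (intervalIntegral.integral_hasDerivAt_right
    (hint.intervalIntegrable (a := 0) (b := x))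
    (hcont.stronglyMeasurableAtFilter _ _) hcont.continuousAt).const_add
      (cdf (gaussianReal 0 1) 0)
  exact hderiv.congr_of_eventuallyEq (Eventually.of_forall hsplit)

lemma gaussianPDFReal_zero_one (x : ℝ) :
    gaussianPDFReal 0 1 x = (√(2 * π))⁻¹ * rexp (-x ^ 2 / 2) := by
  simp [gaussianPDFReal_def]

/-- The density `(2πl)^(-1/2) exp (-(l - b)² / (2l))` of a reciprocal inverse Gaussian law. -/
noncomputable def scaleMixtureKernel (b l : ℝ) : ℝ :=
  (√l)⁻¹ * gaussianPDFReal 0 1 (√l - b / √l)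

lemma scaleMixtureKernel_pos (b : ℝ) {l : ℝ} (hl : 0 < l) : 0 < scaleMixtureKernel b l :=
  mul_pos (inv_pos.2 (sqrt_pos.2 hl)) (gaussianPDFReal_pos 0 1 _ one_ne_zero)

lemma log_scaleMixtureKernel (b : ℝ) {l : ℝ} (hl : 0 < l) :
    log (scaleMixtureKernel b l) = -(1 / 2 * log (2 * π * l)) - (l - b) ^ 2 / (2 * l) := by
  have hs : 0 < √l := sqrt_pos.2 hl
  have hp : 0 < 2 * π := by positivity
  rw [scaleMixtureKernel, gaussianPDFReal_zero_one, log_mul (by positivity) (by positivity),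
    log_mul (by positivity) (by positivity), log_exp, log_inv, log_inv, log_sqrt hl.le,
    log_sqrt hp.le, log_mul hp.ne' hl.ne']
  have hsq : (√l - b / √l) ^ 2 = (l - b) ^ 2 / l := by
    rw [← sq_sqrt hl.le, sqrt_sq hs.le]
    field_simp
  rw [hsq]
  field_simp
  ring

/-- An antiderivative of `scaleMixtureKernel b` on the positive half-line, away from `0`. -/
noncomputable def scaleMixtureCDF (b l : ℝ) : ℝ :=
  cdf (gaussianReal 0 1) (√l - b / √l) - rexp (2 * b) * cdf (gaussianReal 0 1) (-√l - b / √l)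

lemma hasDerivAt_scaleMixtureCDF (b : ℝ) {l : ℝ} (hl : 0 < l) :
    HasDerivAt (scaleMixtureCDF b) (scaleMixtureKernel b l) l := by
  have hs : 0 < √l := sqrt_pos.2 hl
  have hsqrt := hasDerivAt_sqrt hl.ne'
  have hdiv := (hsqrt.inv hs.ne').const_mul b
  have hu := (hasDerivAt_cdf_gaussianReal (√l - b * (√l)⁻¹)).comp l (hsqrt.sub hdiv)
  have hv := (hasDerivAt_cdf_gaussianReal (-√l - b * (√l)⁻¹)).comp l (hsqrt.neg.sub hdiv)
  have hshift : rexp (2 * b) * gaussianPDFReal 0 1 (-√l - b * (√l)⁻¹) =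
      gaussianPDFReal 0 1 (√l - b * (√l)⁻¹) := by
    rw [gaussianPDFReal_zero_one, gaussianPDFReal_zero_one, mul_left_comm, ← exp_add]
    congr 2
    field_simp
    ring
  refine (hu.sub (hv.const_mul (rexp (2 * b)))).congr_deriv ?_
  rw [← mul_assoc, hshift, scaleMixtureKernel, div_eq_mul_inv b]
  field_simp
  ring

lemma tendsto_scaleMixtureCDF_atTop (b : ℝ) :
    Tendsto (scaleMixtureCDF b) atTop (𝓝 1) := by
  have hdiv : Tendsto (fun l : ℝ => -(b / √l)) atTop (𝓝 (-0)) :=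
    (tendsto_sqrt_atTop.const_div_atTop b).neg
  have hu : Tendsto (fun l : ℝ => √l - b / √l) atTop atTop := by
    simpa only [sub_eq_add_neg] using tendsto_sqrt_atTop.atTop_add hdiv
  have hv : Tendsto (fun l : ℝ => -√l - b / √l) atTop atBot := by
    simpa only [sub_eq_add_neg, Function.comp_def] using
      (tendsto_neg_atTop_atBot.comp tendsto_sqrt_atTop).atBot_add hdiv
  unfold scaleMixtureCDF
  simpa using ((tendsto_cdf_atTop (gaussianReal 0 1)).comp hu).sub
    (((tendsto_cdf_atBot (gaussianReal 0 1)).comp hv).const_mul (rexp (2 * b)))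

lemma tendsto_scaleMixtureCDF_zero {b : ℝ} (hb : 0 ≤ b) :
    Tendsto (scaleMixtureCDF b) (𝓝[>] 0) (𝓝 0) := by
  have hsqrt : Tendsto (fun l : ℝ => √l) (𝓝[>] 0) (𝓝 0) := by
    simpa using (continuous_sqrt.tendsto 0).mono_left nhdsWithin_le_nhds
  rcases hb.eq_or_lt with rfl | hb
  · have hcdf := (hasDerivAt_cdf_gaussianReal 0).continuousAt.tendsto
    have hneg : Tendsto (fun l : ℝ => -√l) (𝓝[>] 0) (𝓝 0) := by simpa using hsqrt.neg
    unfold scaleMixtureCDF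
    simpa [Function.comp_def] using (hcdf.comp hsqrt).sub (hcdf.comp hneg)
  · have hsqrt_pos : Tendsto (fun l : ℝ => √l) (𝓝[>] 0) (𝓝[>] 0) :=
      tendsto_nhdsWithin_iff.2 ⟨hsqrt, eventually_mem_nhdsWithin.mono fun _ hl => sqrt_pos.2 hl⟩
    have hdiv : Tendsto (fun l : ℝ => -(b / √l)) (𝓝[>] 0) atBot := by
      simp only [div_eq_mul_inv]
      exact tendsto_neg_atTop_atBot.comp
        ((tendsto_inv_nhdsGT_zero.comp hsqrt_pos).const_mul_atTop hb)
    have hu : Tendsto (fun l : ℝ => √l - b / √l) (𝓝[>] 0) atBot := by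
      simpa only [sub_eq_add_neg] using hsqrt.add_atBot hdiv
    have hv : Tendsto (fun l : ℝ => -√l - b / √l) (𝓝[>] 0) atBot := by
      simpa only [sub_eq_add_neg] using hsqrt.neg.add_atBot hdiv
    have hcdf := tendsto_cdf_atBot (gaussianReal 0 1)
    unfold scaleMixtureCDF
    simpa using (hcdf.comp hu).sub ((hcdf.comp hv).const_mul (rexp (2 * b)))

lemma integrableOn_scaleMixtureKernel_and_integral {b : ℝ} (hb : 0 ≤ b) :
    IntegrableOn (scaleMixtureKernel b) (Set.Ioi 0) ∧
      ∫ l in Set.Ioi (0 : ℝ), scaleMixtureKernel b l = 1 := by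
  have hcont : ContinuousWithinAt (Function.update (scaleMixtureCDF b) 0 0) (Set.Ici 0) 0 := by
    rw [continuousWithinAt_update_same, Set.Ici_sdiff_left]
    exact tendsto_scaleMixtureCDF_zero hb
  have hderiv : ∀ l ∈ Set.Ioi (0 : ℝ),
      HasDerivAt (Function.update (scaleMixtureCDF b) 0 0) (scaleMixtureKernel b l) l := by
    intro l hl
    refine (hasDerivAt_scaleMixtureCDF b hl).congr_of_eventuallyEq ?_
    filter_upwards [lt_mem_nhds hl] with y hy
    exact Function.update_of_ne hy.ne' _ _
  have hlim : Tendsto (Function.update (scaleMixtureCDF b) 0 0) atTop (𝓝 1) := by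
    refine (tendsto_scaleMixtureCDF_atTop b).congr' ?_
    filter_upwards [eventually_gt_atTop 0] with y hy
    exact (Function.update_of_ne hy.ne' _ _).symm
  have hpos : ∀ l ∈ Set.Ioi (0 : ℝ), 0 ≤ scaleMixtureKernel b l :=
    fun l hl => (scaleMixtureKernel_pos b hl).le
  refine ⟨integrableOn_Ioi_deriv_of_nonneg hcont hderiv hpos hlim, ?_⟩
  simpa using integral_Ioi_of_hasDerivAt_of_nonneg hcont hderiv hpos hlim

/-- The pointwise form of Gibbs' inequality. -/
lemma sub_le_mul_log_sub_log {x y : ℝ} (hx : 0 ≤ x) (hy : 0 < y) :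
    x - y ≤ x * (log x - log y) := by
  rcases hx.eq_or_lt with rfl | hx
  · simpa using hy.le
  · have h := mul_le_mul_of_nonneg_left (one_sub_inv_le_log_of_pos (div_pos hx hy)) hx.le
    rw [log_div hx.ne' hy.ne', inv_div, mul_sub, mul_div_cancel₀ y hx.ne'] at h
    simpa using h

lemma add_sq_div_eq_sub_abs_sq_div (a : ℝ) {l : ℝ} (hl : 0 < l) :
    (l + a) ^ 2 / (2 * l) = (l - |a|) ^ 2 / (2 * l) + 2 * max 0 a := by
  rcases le_total 0 a with ha | ha
  · rw [abs_of_nonneg ha, max_eq_right ha]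
    field_simp
    ring
  · rw [abs_of_nonpos ha, max_eq_left ha]
    ring

/-- Variational upper bound on the hinge loss obtained from the scale-mixture
representation and Jensen's inequality: for `c > 0`, `ζ : ℝ`, and any probability
density `q` on `(0,∞)` with the required integrability,
`2c·max(0,ζ) ≤ ∫ q(λ)[log q(λ) + ½ log(2πλ) + (λ + cζ)²/(2λ)] dλ`. -/
theorem hinge_variational_bound (c : ℝ) (hc : 0 < c) (ζ : ℝ) (q : ℝ → ℝ)
    (hq_meas : Measurable q)
    (hq_nonneg : ∀ l ∈ Set.Ioi (0 : ℝ), 0 ≤ q l)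
    (hq_int : ∫ l in Set.Ioi (0 : ℝ), q l = 1)
    (h1 : IntegrableOn (fun l => q l * Real.log (q l)) (Set.Ioi 0))
    (h2 : IntegrableOn (fun l => q l * Real.log l) (Set.Ioi 0))
    (h3 : IntegrableOn (fun l => l * q l) (Set.Ioi 0))
    (h4 : IntegrableOn (fun l => q l / l) (Set.Ioi 0)) :
    2 * c * max 0 ζ ≤
      ∫ l in Set.Ioi (0 : ℝ),
        q l * (Real.log (q l) + (1 / 2) * Real.log (2 * π * l) + (l + c * ζ) ^ 2 / (2 * l)) := by
  have hq : IntegrableOn q (Set.Ioi 0) := by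
    by_contra h
    rw [integral_undef h] at hq_int
    exact zero_ne_one hq_int
  obtain ⟨hk, hk_int⟩ := integrableOn_scaleMixtureKernel_and_integral (abs_nonneg (c * ζ))
  have hlower : IntegrableOn
      (fun l => q l - scaleMixtureKernel |c * ζ| l + 2 * c * max 0 ζ * q l) (Set.Ioi 0) :=
    (hq.sub hk).add (hq.const_mul _)
  have hupper : IntegrableOn (fun l => q l *
      (Real.log (q l) + (1 / 2) * Real.log (2 * π * l) + (l + c * ζ) ^ 2 / (2 * l)))
      (Set.Ioi 0) := by
    refine ((((h1.add (h2.const_mul (1 / 2))).add (h3.const_mul (1 / 2))).add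
      (h4.const_mul ((c * ζ) ^ 2 / 2))).add
      (hq.const_mul (1 / 2 * log (2 * π) + c * ζ))).congr_fun ?_ measurableSet_Ioi
    intro l hl
    have hl : 0 < l := hl
    simp only [Pi.add_apply]
    rw [log_mul (x := 2 * π) (by positivity) hl.ne']
    field_simp
    ring
  calc 2 * c * max 0 ζ
      = ∫ l in Set.Ioi (0 : ℝ),
          (q l - scaleMixtureKernel |c * ζ| l + 2 * c * max 0 ζ * q l) := by
        rw [integral_add (f := fun l => q l - scaleMixtureKernel |c * ζ| l) (hq.sub hk)
          (hq.const_mul _), integral_sub hq hk, integral_const_mul, hq_int, hk_int]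
        ring
    _ ≤ _ := by
        refine setIntegral_mono_on hlower hupper measurableSet_Ioi fun l hl => ?_
        have hgibbs := sub_le_mul_log_sub_log (hq_nonneg l hl)
          (scaleMixtureKernel_pos |c * ζ| hl)
        have hmax : max 0 (c * ζ) = c * max 0 ζ := by
          rw [mul_max_of_nonneg _ _ hc.le, mul_zero]
        rw [log_scaleMixtureKernel _ hl] at hgibbs
        rw [add_sq_div_eq_sub_abs_sq_div _ hl, hmax]
        linarith
end

section
/- Let b > 0. Over all probability densities q on (0, ∞) for which the integrand below is integrable, the functional F(q) = ∫₀^∞ q(λ) [ log q(λ) + (1/2) log λ + λ/2 + b/(2λ) ] dλ satisfies F(q) ≥ √b − (1/2) log(2π), with equality if and only if q equals (almost everywhere) the density q*(λ) = e^{√b} · (2πλ)^{-1/2} · exp(−(λ + b/λ)/2), i.e., the generalized inverse Gaussian density GIG(λ; 1/2, 1, b). (Optimality of the E-step variational distribution for the expected hinge loss.) -/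
open MeasureTheory Real

/-- The density of `GIG(1/2, 1, b)` on `(0, ∞)`. -/
noncomputable def gigHalfPDF (b l : ℝ) : ℝ :=
  exp √b * ((2 * π * l) ^ (-(1 : ℝ) / 2) * exp (-(l + b / l) / 2))

lemma gigHalfPDF_pos (b : ℝ) {l : ℝ} (hl : 0 < l) : 0 < gigHalfPDF b l := by
  unfold gigHalfPDF
  positivity

lemma log_gigHalfPDF (b : ℝ) {l : ℝ} (hl : 0 < l) :
    log (gigHalfPDF b l) =
      √b - (1 / 2) * log (2 * π) - ((1 / 2) * log l + l / 2 + b / (2 * l)) := by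
  have hbl : b / (2 * l) = b / l / 2 := by field_simp
  rw [gigHalfPDF, log_mul (by positivity) (by positivity), log_mul (by positivity) (by positivity),
    log_exp, log_exp, log_rpow (by positivity), log_mul (by positivity) hl.ne', hbl]
  ring

/-- The map `x ↦ x - a / x` maps `(0, ∞)` onto `ℝ`. -/
lemma image_sub_div_Ioi {a : ℝ} (ha : 0 < a) :
    (fun x : ℝ => x - a / x) '' Set.Ioi 0 = Set.univ := by
  refine Set.eq_univ_of_forall fun u => ?_
  have hs : √(u ^ 2 + 4 * a) ^ 2 = u ^ 2 + 4 * a := sq_sqrt (by positivity)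
  have hlt : |u| < √(u ^ 2 + 4 * a) := by
    rw [← sqrt_sq_eq_abs]
    exact sqrt_lt_sqrt (by positivity) (by linarith)
  have hpos : 0 < u + √(u ^ 2 + 4 * a) := by linarith [neg_abs_le u]
  refine ⟨(u + √(u ^ 2 + 4 * a)) / 2, by simpa using hpos, ?_⟩
  simp only
  field_simp
  nlinarith

lemma injOn_sub_div_Ioi {a : ℝ} (ha : 0 < a) :
    Set.InjOn (fun x : ℝ => x - a / x) (Set.Ioi 0) := by
  refine StrictMonoOn.injOn fun x hx y _ hxy => ?_
  have := div_lt_div_of_pos_left ha hx hxy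
  linarith

lemma hasDerivAt_const_div (a : ℝ) {x : ℝ} (hx : x ≠ 0) :
    HasDerivAt (fun x : ℝ => a / x) (-(a / x ^ 2)) x :=
  ((hasDerivAt_const x a).fun_div (hasDerivAt_id' x) hx).congr_deriv (by ring)

lemma hasDerivAt_sub_div (a : ℝ) {x : ℝ} (hx : x ≠ 0) :
    HasDerivAt (fun x : ℝ => x - a / x) (1 + a / x ^ 2) x :=
  ((hasDerivAt_id' x).fun_sub (hasDerivAt_const_div a hx)).congr_deriv (by ring)

lemma integrable_exp_neg_sq_div_two : Integrable fun u : ℝ => exp (-u ^ 2 / 2) := by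
  convert integrable_exp_neg_mul_sq (b := 1 / 2) (by norm_num) using 3
  ring

lemma integral_exp_neg_sq_div_two : ∫ u : ℝ, exp (-u ^ 2 / 2) = √(2 * π) := by
  rw [show 2 * π = π / (1 / 2) by ring, ← integral_gaussian]
  congr! 3
  ring

lemma abs_deriv_smul_sub_div {a : ℝ} (ha : 0 < a) (x : ℝ) :
    |1 + a / x ^ 2| • exp (-(x - a / x) ^ 2 / 2) =
      exp (-(x - a / x) ^ 2 / 2) + a / x ^ 2 * exp (-(x - a / x) ^ 2 / 2) := by
  rw [abs_of_nonneg (by positivity), smul_eq_mul]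
  ring

lemma integrableOn_exp_sub_div_add {a : ℝ} (ha : 0 < a) :
    IntegrableOn (fun x : ℝ => exp (-(x - a / x) ^ 2 / 2) +
      a / x ^ 2 * exp (-(x - a / x) ^ 2 / 2)) (Set.Ioi 0) := by
  have h := (integrableOn_image_iff_integrableOn_abs_deriv_smul measurableSet_Ioi
    (fun x hx => (hasDerivAt_sub_div a (ne_of_gt hx)).hasDerivWithinAt)
    (injOn_sub_div_Ioi ha) (fun u : ℝ => exp (-u ^ 2 / 2))).1
    integrable_exp_neg_sq_div_two.integrableOn
  simpa only [abs_deriv_smul_sub_div ha] using h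

lemma integral_exp_sub_div_add {a : ℝ} (ha : 0 < a) :
    ∫ x in Set.Ioi (0 : ℝ), (exp (-(x - a / x) ^ 2 / 2) +
      a / x ^ 2 * exp (-(x - a / x) ^ 2 / 2)) = √(2 * π) := by
  have h := integral_image_eq_integral_abs_deriv_smul measurableSet_Ioi
    (fun x hx => (hasDerivAt_sub_div a (ne_of_gt hx)).hasDerivWithinAt)
    (injOn_sub_div_Ioi ha) (fun u : ℝ => exp (-u ^ 2 / 2))
  simp only [abs_deriv_smul_sub_div ha] at h
  rw [← h, image_sub_div_Ioi ha, setIntegral_univ, integral_exp_neg_sq_div_two]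

lemma integrableOn_exp_sub_div {a : ℝ} (ha : 0 < a) :
    IntegrableOn (fun x : ℝ => exp (-(x - a / x) ^ 2 / 2)) (Set.Ioi 0) := by
  refine (integrableOn_exp_sub_div_add ha).mono' (by fun_prop) (ae_of_all _ fun x => ?_)
  rw [norm_of_nonneg (exp_pos _).le]
  have : 0 ≤ a / x ^ 2 * exp (-(x - a / x) ^ 2 / 2) := by positivity
  linarith

/-- Substituting `a / x` for `x` leaves `(x - a / x) ^ 2` invariant. -/
lemma integral_div_sq_mul_exp_sub_div {a : ℝ} (ha : 0 < a) :
    ∫ x in Set.Ioi (0 : ℝ), a / x ^ 2 * exp (-(x - a / x) ^ 2 / 2) =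
      ∫ x in Set.Ioi (0 : ℝ), exp (-(x - a / x) ^ 2 / 2) := by
  have hderiv : ∀ x ∈ Set.Ioi (0 : ℝ),
      HasDerivWithinAt (fun x : ℝ => a / x) (-(a / x ^ 2)) (Set.Ioi 0) x := fun x hx =>
    (hasDerivAt_const_div a (ne_of_gt hx)).hasDerivWithinAt
  have hinvol : ∀ x ∈ Set.Ioi (0 : ℝ), a / (a / x) = x := fun x _ => div_div_cancel₀ ha.ne'
  have hinj : Set.InjOn (fun x : ℝ => a / x) (Set.Ioi 0) :=
    Set.LeftInvOn.injOn (f₁' := fun x => a / x) hinvol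
  have himage : (fun x : ℝ => a / x) '' Set.Ioi 0 = Set.Ioi 0 := by
    refine Set.Subset.antisymm ?_ fun x hx => ⟨a / x, div_pos ha hx, hinvol x hx⟩
    rintro _ ⟨x, hx, rfl⟩
    exact div_pos ha hx
  have h := integral_image_eq_integral_abs_deriv_smul measurableSet_Ioi hderiv hinj
    (fun x : ℝ => exp (-(x - a / x) ^ 2 / 2))
  rw [himage] at h
  rw [h]
  refine setIntegral_congr_fun measurableSet_Ioi fun x hx => ?_
  rw [abs_neg, abs_of_nonneg (by positivity), smul_eq_mul, hinvol x hx, sub_sq_comm]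

lemma integral_exp_sub_div {a : ℝ} (ha : 0 < a) :
    ∫ x in Set.Ioi (0 : ℝ), exp (-(x - a / x) ^ 2 / 2) = √(2 * π) / 2 := by
  have h := integral_exp_sub_div_add ha
  have hdiv : IntegrableOn (fun x : ℝ => a / x ^ 2 * exp (-(x - a / x) ^ 2 / 2)) (Set.Ioi 0) := by
    refine ((integrableOn_exp_sub_div_add ha).sub (integrableOn_exp_sub_div ha)).congr
      (ae_of_all _ fun x => ?_)
    simp
  rw [integral_add (integrableOn_exp_sub_div ha) hdiv, integral_div_sq_mul_exp_sub_div ha] at h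
  linarith

lemma gigHalfPDF_sq {b x : ℝ} (hb : 0 ≤ b) (hx : 0 < x) :
    2 * x * gigHalfPDF b (x ^ 2) = 2 / √(2 * π) * exp (-(x - √b / x) ^ 2 / 2) := by
  have hrpow : (2 * π * x ^ 2) ^ (-(1 : ℝ) / 2) = 1 / (√(2 * π) * x) := by
    rw [neg_div, rpow_neg (by positivity), ← sqrt_eq_rpow, sqrt_mul (by positivity),
      sqrt_sq hx.le, one_div]
  have hexp : -(x - √b / x) ^ 2 / 2 = √b + -(x ^ 2 + b / x ^ 2) / 2 := by
    field_simp
    linear_combination -(sq_sqrt hb)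
  rw [gigHalfPDF, hrpow, hexp, exp_add]
  field_simp

lemma integral_gigHalfPDF {b : ℝ} (hb : 0 < b) :
    ∫ l in Set.Ioi (0 : ℝ), gigHalfPDF b l = 1 := by
  rw [← integral_comp_rpow_Ioi_of_pos (p := 2) two_pos]
  have h : Set.EqOn (fun x : ℝ => (2 * x ^ ((2 : ℝ) - 1)) • gigHalfPDF b (x ^ (2 : ℝ)))
      (fun x => 2 / √(2 * π) * exp (-(x - √b / x) ^ 2 / 2)) (Set.Ioi 0) := fun x hx => by
    simp only
    rw [← gigHalfPDF_sq hb.le hx, show (2 : ℝ) - 1 = 1 by norm_num, rpow_one, rpow_two, smul_eq_mul]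
  rw [setIntegral_congr_fun measurableSet_Ioi h, integral_const_mul,
    integral_exp_sub_div (sqrt_pos.2 hb)]
  have : √(2 * π) ≠ 0 := by positivity
  field_simp

lemma integrableOn_gigHalfPDF {b : ℝ} (hb : 0 < b) :
    IntegrableOn (gigHalfPDF b) (Set.Ioi 0) := by
  refine not_imp_comm.1 integral_undef ?_
  rw [integral_gigHalfPDF hb]
  exact one_ne_zero

/-- The pointwise form of the Gibbs inequality, through `InformationTheory.klFun`. -/
lemma mul_log_sub_log_sub_eq_mul_klFun {p q : ℝ} (hp : 0 < p) (hq : 0 ≤ q) :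
    q * (log q - log p) - (q - p) = p * InformationTheory.klFun (q / p) := by
  rcases hq.eq_or_lt with rfl | hq
  · simp [InformationTheory.klFun]
  · rw [InformationTheory.klFun, log_div hq.ne' hp.ne']
    field_simp
    ring

/-- Optimality of the E-step variational distribution for the expected hinge loss:
for `b > 0` and any probability density `q` on `(0,∞)` making the integrand
integrable, `F(q) = ∫ q(λ)[log q(λ) + ½ log λ + λ/2 + b/(2λ)] dλ ≥ √b − ½ log(2π)`,
with equality iff `q` equals a.e. the GIG(1/2, 1, b) density
`q*(λ) = e^{√b} (2πλ)^{-1/2} exp(-(λ + b/λ)/2)`. -/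
theorem gig_estep_optimality (b : ℝ) (hb : 0 < b) (q : ℝ → ℝ)
    (hq_meas : Measurable q)
    (hq_nonneg : ∀ l ∈ Set.Ioi (0 : ℝ), 0 ≤ q l)
    (hq_int : ∫ l in Set.Ioi (0 : ℝ), q l = 1)
    (hint : IntegrableOn (fun l =>
      q l * (Real.log (q l) + (1 / 2) * Real.log l + l / 2 + b / (2 * l))) (Set.Ioi 0)) :
    Real.sqrt b - (1 / 2) * Real.log (2 * π) ≤
      (∫ l in Set.Ioi (0 : ℝ),
        q l * (Real.log (q l) + (1 / 2) * Real.log l + l / 2 + b / (2 * l))) ∧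
    ((∫ l in Set.Ioi (0 : ℝ),
        q l * (Real.log (q l) + (1 / 2) * Real.log l + l / 2 + b / (2 * l)))
        = Real.sqrt b - (1 / 2) * Real.log (2 * π) ↔
      q =ᵐ[volume.restrict (Set.Ioi 0)] fun l =>
        Real.exp (Real.sqrt b) * ((2 * π * l) ^ (-(1 : ℝ) / 2) * Real.exp (-(l + b / l) / 2))) := by
  set F := fun l => q l * (log (q l) + (1 / 2) * log l + l / 2 + b / (2 * l)) with hF
  set c := √b - (1 / 2) * log (2 * π) with hc
  have hq_integrable : IntegrableOn q (Set.Ioi 0) := by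
    refine not_imp_comm.1 integral_undef ?_
    rw [hq_int]
    exact one_ne_zero
  have hg := integrableOn_gigHalfPDF hb
  set D := fun l => F l - c * q l - (q l - gigHalfPDF b l) with hD
  have hD_int : IntegrableOn D (Set.Ioi 0) :=
    (hint.sub (hq_integrable.const_mul c)).sub (hq_integrable.sub hg)
  have hD_eq : ∀ l ∈ Set.Ioi (0 : ℝ),
      D l = gigHalfPDF b l * InformationTheory.klFun (q l / gigHalfPDF b l) := fun l hl => by
    rw [← mul_log_sub_log_sub_eq_mul_klFun (gigHalfPDF_pos b hl) (hq_nonneg l hl),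
      log_gigHalfPDF b hl]
    simp only [hD, hF, hc]
    ring
  have hratio : ∀ l ∈ Set.Ioi (0 : ℝ), 0 ≤ q l / gigHalfPDF b l := fun l hl =>
    div_nonneg (hq_nonneg l hl) (gigHalfPDF_pos b hl).le
  have hD_nonneg : 0 ≤ᵐ[volume.restrict (Set.Ioi 0)] D := by
    filter_upwards [ae_restrict_mem measurableSet_Ioi] with l hl
    rw [Pi.zero_apply, hD_eq l hl]
    exact mul_nonneg (gigHalfPDF_pos b hl).le (InformationTheory.klFun_nonneg (hratio l hl))
  have hD_integral : ∫ l in Set.Ioi (0 : ℝ), D l = (∫ l in Set.Ioi (0 : ℝ), F l) - c := by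
    have hFc : IntegrableOn (fun l => F l - c * q l) (Set.Ioi 0) :=
      hint.sub (hq_integrable.const_mul c)
    have hqg : IntegrableOn (fun l => q l - gigHalfPDF b l) (Set.Ioi 0) := hq_integrable.sub hg
    rw [integral_sub hFc hqg, integral_sub hint (hq_integrable.const_mul c), integral_sub hq_integrable hg,
      integral_const_mul, hq_int, integral_gigHalfPDF hb]
    ring
  refine ⟨by linarith [integral_nonneg_of_ae hD_nonneg], ?_⟩
  change _ ↔ q =ᵐ[volume.restrict (Set.Ioi 0)] gigHalfPDF b
  rw [← sub_eq_zero, ← hD_integral, integral_eq_zero_iff_of_nonneg_ae hD_nonneg hD_int]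
  refine Filter.eventually_congr ?_
  filter_upwards [ae_restrict_mem measurableSet_Ioi] with l hl
  have hpos := gigHalfPDF_pos b hl
  rw [Pi.zero_apply, hD_eq l hl, mul_eq_zero_iff_left hpos.ne',
    InformationTheory.klFun_eq_zero_iff (hratio l hl), div_eq_one_iff_eq hpos.ne']
end
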